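/- arXiv:2208.07229 — 2 statements merged into one kernel-verified Lean document; each statement's English description precedes it below -/
import Mathlib

section
/- For every integer m ≥ 1 and every real (or complex) number λ, the resultant of the polynomials S_m(x) − λ·S_{m−1}(x) and ∑_{k=0}^{m−1} S_k(x) equals (−1)^{m(m−1)/2}·(−λ)^⌊m/2⌋. Equivalently, if μ^{(1)}, …, μ^{(m)} are the roots (with multiplicity, over ℂ) of S_m(x) − λ·S_{m−1}(x), then ∏_{j=1}^m ∑_{k=0}^{m−1} S_k(μ^{(j)}) = (−1)^{m(m−1)/2}·(−λ)^⌊m/2⌋. -/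
open Polynomial

/-- The renormalized Chebyshev polynomial of the second kind, `S k x = U k (x/2)`. -/
noncomputable def chebS (k : ℤ) : Polynomial ℂ :=
  (Polynomial.Chebyshev.U ℂ k).comp (Polynomial.C 2⁻¹ * Polynomial.X)

/-- The resultant of two complex polynomials `f = aₙ∏(x-αᵢ)`, `g = bₘ∏(x-βⱼ)`:
`Res(f,g) = aₙ^m · bₘ^n · ∏ᵢⱼ (αᵢ - βⱼ)`. -/
noncomputable def res (f g : Polynomial ℂ) : ℂ :=
  f.leadingCoeff ^ g.natDegree * g.leadingCoeff ^ f.natDegree *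
    (f.roots.map fun a => (g.roots.map fun b => a - b).prod).prod

/-- Replacing a product over the roots of `p` by one over the roots of `q`, for monic polynomials
such that `p` is constant on the roots of `q`. -/
lemma prod_roots_eval_of_eval_eq_const {K : Type*} [Field K] [IsAlgClosed K] {p q : K[X]} {c : K}
    (hp : p.Monic) (hq : q.Monic) (h : ∀ x, q.eval x = 0 → p.eval x = c) :
    (p.roots.map q.eval).prod = (-1) ^ (p.natDegree * q.natDegree) * c ^ q.natDegree := by
  have hpq := resultant_eq_prod_eval p q q.natDegree le_rfl (IsAlgClosed.splits p)
  have hqp := resultant_eq_prod_eval q p p.natDegree le_rfl (IsAlgClosed.splits q)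
  have hc : q.roots.map p.eval = q.roots.map fun _ => c :=
    Multiset.map_congr rfl fun x hx => h x (isRoot_of_mem_roots hx)
  rw [hp.leadingCoeff, one_pow, one_mul] at hpq
  rw [hq.leadingCoeff, one_pow, one_mul, hc, Multiset.map_const', Multiset.prod_replicate,
    ← (IsAlgClosed.splits q).natDegree_eq_card_roots] at hqp
  rw [← hpq, resultant_comm, hqp]

lemma res_eq_prod_roots_eval {f g : ℂ[X]} (hf : f.Monic) (hg : g.Monic) :
    res f g = (f.roots.map g.eval).prod := by
  simp only [res, hf.leadingCoeff, hg.leadingCoeff, one_pow, one_mul]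
  congr 1
  exact Multiset.map_congr rfl fun x _ =>
    ((IsAlgClosed.splits g).eval_eq_prod_roots_of_monic hg x).symm

lemma chebS_zero : chebS 0 = 1 := by simp [chebS]

lemma chebS_neg_one : chebS (-1) = 0 := by simp [chebS]

lemma chebS_one : chebS 1 = X := by
  simp [chebS, ← mul_assoc, ← C_ofNat, ← C_mul, -map_mul]

lemma chebS_add_one (n : ℤ) : chebS (n + 1) = X * chebS n - chebS (n - 1) := by
  have h : (2 : ℂ[X]) * (C 2⁻¹ * X) = X := by
    rw [← mul_assoc, ← C_ofNat, ← C_mul]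
    simp
  simp [chebS, Chebyshev.U_add_one, h]

lemma natDegree_chebS (n : ℕ) : (chebS n).natDegree = n := by
  rw [chebS, natDegree_comp, Chebyshev.natDegree_U_natCast, natDegree_C_mul_X _ (by norm_num),
    mul_one]

lemma monic_chebS (n : ℕ) : (chebS n).Monic := by
  rw [Monic, chebS, leadingCoeff_comp (by rw [natDegree_C_mul_X _ (by norm_num)]; norm_num),
    Chebyshev.leadingCoeff_U_natCast, Chebyshev.natDegree_U_natCast, leadingCoeff_C_mul_X,
    ← mul_pow]
  norm_num

lemma degree_chebS_sub_one_lt (n : ℕ) : (chebS ((n : ℤ) - 1)).degree < (chebS n).degree := by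
  rw [degree_eq_natDegree (monic_chebS n).ne_zero, natDegree_chebS]
  cases n with
  | zero => simp [chebS_neg_one]
  | succ n =>
    rw [Nat.cast_succ, add_sub_cancel_right, degree_eq_natDegree (monic_chebS n).ne_zero,
      natDegree_chebS]
    exact_mod_cast n.lt_succ_self

lemma degree_C_mul_chebS_sub_one_lt (n : ℕ) (c : ℂ) :
    (C c * chebS ((n : ℤ) - 1)).degree < (chebS n).degree := by
  rw [← smul_eq_C_mul]
  exact (degree_smul_le c _).trans_lt (degree_chebS_sub_one_lt n)

lemma monic_chebS_sub (n : ℕ) (c : ℂ) : (chebS n - C c * chebS ((n : ℤ) - 1)).Monic :=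
  (monic_chebS n).sub_of_left (degree_C_mul_chebS_sub_one_lt n c)

lemma natDegree_chebS_sub (n : ℕ) (c : ℂ) :
    (chebS n - C c * chebS ((n : ℤ) - 1)).natDegree = n :=
  (natDegree_eq_natDegree (degree_sub_eq_left_of_degree_lt
    (degree_C_mul_chebS_sub_one_lt n c))).trans (natDegree_chebS n)

lemma monic_chebS_add (n : ℕ) : (chebS n + chebS ((n : ℤ) - 1)).Monic :=
  (monic_chebS n).add_of_left (degree_chebS_sub_one_lt n)

lemma natDegree_chebS_add (n : ℕ) : (chebS n + chebS ((n : ℤ) - 1)).natDegree = n :=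
  (natDegree_add_eq_left_of_degree_lt (degree_chebS_sub_one_lt n)).trans (natDegree_chebS n)

lemma chebS_sq_add_sq (n : ℕ) :
    chebS n ^ 2 + chebS ((n : ℤ) - 1) ^ 2 - X * chebS n * chebS ((n : ℤ) - 1) = 1 := by
  induction n with
  | zero => simp [chebS_zero, chebS_neg_one]
  | succ n ih =>
    rw [Nat.cast_succ, add_sub_cancel_right, chebS_add_one]
    linear_combination ih

lemma chebS_two_mul_and_add_one (n : ℕ) :
    chebS (2 * n) = chebS n ^ 2 - chebS ((n : ℤ) - 1) ^ 2 ∧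
      chebS (2 * n + 1) = chebS n * (chebS (n + 1) - chebS ((n : ℤ) - 1)) := by
  induction n with
  | zero => simp [chebS_zero, chebS_neg_one, chebS_one]
  | succ n ih =>
    obtain ⟨he, ho⟩ := ih
    have h₂ : chebS (2 * n + 2) = X * chebS (2 * n + 1) - chebS (2 * n) := by
      simpa [add_assoc] using chebS_add_one (2 * n + 1)
    have h₃ : chebS (2 * n + 3) = X * chebS (2 * n + 2) - chebS (2 * n + 1) := by
      have := chebS_add_one (2 * n + 2)
      rwa [add_assoc, add_sub_assoc] at this
    have h₄ := chebS_add_one (n + 1 : ℤ)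
    have h₅ := chebS_add_one (n : ℤ)
    rw [add_sub_cancel_right] at h₄
    push_cast
    rw [add_sub_cancel_right, mul_add, mul_one, add_assoc (2 * (n : ℤ)),
      show (2 : ℤ) + 1 = 3 by norm_num, h₃, h₂, ho, he, h₄, h₅]
    constructor <;> ring

lemma chebS_two_mul (n : ℕ) : chebS (2 * n) = chebS n ^ 2 - chebS ((n : ℤ) - 1) ^ 2 :=
  (chebS_two_mul_and_add_one n).1

lemma chebS_two_mul_add_one (n : ℕ) :
    chebS (2 * n + 1) = chebS n * (X * chebS n - 2 * chebS ((n : ℤ) - 1)) := by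
  rw [(chebS_two_mul_and_add_one n).2, chebS_add_one]
  ring

lemma chebS_two_mul_sub_one (n : ℕ) :
    chebS (2 * n - 1) = chebS ((n : ℤ) - 1) * (2 * chebS n - X * chebS ((n : ℤ) - 1)) := by
  have h := chebS_add_one (2 * n)
  rw [chebS_two_mul, chebS_two_mul_add_one] at h
  linear_combination h

lemma sum_range_two_mul_chebS (n : ℕ) :
    ∑ k ∈ Finset.range (2 * n), chebS k =
      chebS ((n : ℤ) - 1) * (chebS n + chebS ((n : ℤ) - 1)) := by
  induction n with
  | zero => simp [chebS_neg_one]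
  | succ n ih =>
    rw [mul_add, mul_one, Finset.sum_range_succ, Finset.sum_range_succ, ih]
    push_cast
    rw [chebS_two_mul, chebS_two_mul_add_one, add_sub_cancel_right, chebS_add_one]
    ring

lemma sum_range_two_mul_add_one_chebS (n : ℕ) :
    ∑ k ∈ Finset.range (2 * n + 1), chebS k =
      chebS n * (chebS n + chebS ((n : ℤ) - 1)) := by
  rw [Finset.sum_range_succ, sum_range_two_mul_chebS]
  push_cast
  rw [chebS_two_mul]
  ring

lemma eval_chebS_sq_add_sq (n : ℕ) (x : ℂ) :
    (chebS n).eval x ^ 2 + (chebS ((n : ℤ) - 1)).eval x ^ 2 -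
      x * (chebS n).eval x * (chebS ((n : ℤ) - 1)).eval x = 1 := by
  simpa using congrArg (eval x) (chebS_sq_add_sq n)

lemma monic_sum_range_chebS {m : ℕ} (hm : 1 ≤ m) :
    (∑ k ∈ Finset.range m, chebS k).Monic := by
  obtain ⟨n, rfl | rfl⟩ := m.even_or_odd'
  · rw [sum_range_two_mul_chebS]
    refine Monic.mul ?_ (monic_chebS_add n)
    rw [← Nat.cast_pred (by omega : 0 < n)]
    exact monic_chebS _
  · rw [sum_range_two_mul_add_one_chebS]
    exact (monic_chebS n).mul (monic_chebS_add n)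

lemma prod_roots_eval_sum_range_two_mul {n : ℕ} (hn : 1 ≤ n) (c : ℂ) :
    ((chebS (2 * n : ℕ) - C c * chebS ((2 * n : ℕ) - 1)).roots.map
      (∑ k ∈ Finset.range (2 * n), chebS k).eval).prod = c ^ n := by
  have hcast : (n : ℤ) - 1 = (n - 1 : ℕ) := by omega
  have hmonic : (chebS ((n : ℤ) - 1)).Monic := hcast ▸ monic_chebS (n - 1)
  rw [sum_range_two_mul_chebS]
  simp only [eval_mul, Multiset.prod_map_mul]
  rw [prod_roots_eval_of_eval_eq_const (c := 1) (monic_chebS_sub _ c) hmonic,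
    prod_roots_eval_of_eval_eq_const (c := c) (monic_chebS_sub _ c) (monic_chebS_add n),
    natDegree_chebS_sub, natDegree_chebS_add]
  · simp [mul_assoc, pow_mul]
  · intro x hx
    have hsq := eval_chebS_sq_add_sq n x
    push_cast
    rw [chebS_two_mul, chebS_two_mul_sub_one]
    simp only [eval_add, eval_sub, eval_mul, eval_pow, eval_C, eval_X, eval_ofNat] at hx ⊢
    rw [eq_neg_of_add_eq_zero_left hx] at hsq ⊢
    linear_combination c * hsq
  · intro x hx
    have hsq := eval_chebS_sq_add_sq n x
    push_cast
    rw [chebS_two_mul, chebS_two_mul_sub_one]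
    simp only [eval_sub, eval_mul, eval_pow, eval_C, eval_X, eval_ofNat]
    rw [hx] at hsq ⊢
    linear_combination hsq

lemma prod_roots_eval_sum_range_two_mul_add_one (n : ℕ) (c : ℂ) :
    ((chebS (2 * n + 1 : ℕ) - C c * chebS ((2 * n + 1 : ℕ) - 1)).roots.map
      (∑ k ∈ Finset.range (2 * n + 1), chebS k).eval).prod = c ^ n := by
  rw [sum_range_two_mul_add_one_chebS]
  simp only [eval_mul, Multiset.prod_map_mul]
  rw [prod_roots_eval_of_eval_eq_const (c := c) (monic_chebS_sub _ c) (monic_chebS n),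
    prod_roots_eval_of_eval_eq_const (c := 1) (monic_chebS_sub _ c) (monic_chebS_add n),
    natDegree_chebS_sub, natDegree_chebS_add, natDegree_chebS, one_pow, mul_one, mul_right_comm,
    ← mul_pow, ← pow_two, ← pow_mul, pow_mul]
  · simp
  · intro x hx
    have hsq := eval_chebS_sq_add_sq n x
    push_cast
    rw [add_sub_cancel_right, chebS_two_mul, chebS_two_mul_add_one]
    simp only [eval_add, eval_sub, eval_mul, eval_pow, eval_C, eval_X, eval_ofNat] at hx ⊢
    rw [eq_neg_of_add_eq_zero_left hx] at hsq ⊢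
    linear_combination hsq
  · intro x hx
    have hsq := eval_chebS_sq_add_sq n x
    push_cast
    rw [add_sub_cancel_right, chebS_two_mul, chebS_two_mul_add_one]
    simp only [eval_sub, eval_mul, eval_pow, eval_C, eval_X, eval_ofNat]
    rw [hx] at hsq ⊢
    linear_combination c * hsq

lemma neg_one_pow_mul_neg_pow_half (m : ℕ) (c : ℂ) :
    (-1) ^ (m * (m - 1) / 2) * (-c) ^ (m / 2) = c ^ (m / 2) := by
  have heven : Even (m * (m - 1) / 2 + m / 2) := by
    obtain ⟨n, rfl | rfl⟩ := m.even_or_odd'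
    · have h₁ : 2 * n * (2 * n - 1) / 2 = n * (2 * n - 1) := by
        rw [mul_assoc, Nat.mul_div_cancel_left _ two_pos]
      rw [h₁, Nat.mul_div_cancel_left _ two_pos]
      cases n with
      | zero => simp
      | succ n => exact ⟨(n + 1) * (n + 1), by rw [show 2 * (n + 1) - 1 = 2 * n + 1 by omega]; ring⟩
    · have h₁ : (2 * n + 1) * (2 * n + 1 - 1) / 2 = (2 * n + 1) * n := by
        rw [Nat.add_sub_cancel, mul_left_comm, Nat.mul_div_cancel_left _ two_pos]
      rw [h₁, show (2 * n + 1) / 2 = n by omega]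
      exact ⟨(n + 1) * n, by ring⟩
  rw [neg_pow c, ← mul_assoc, ← pow_add, heven.neg_one_pow, one_mul]

lemma prod_roots_eval_sum_range_chebS {m : ℕ} (hm : 1 ≤ m) (c : ℂ) :
    ((chebS m - C c * chebS ((m : ℤ) - 1)).roots.map
      (∑ k ∈ Finset.range m, chebS k).eval).prod =
        (-1) ^ (m * (m - 1) / 2) * (-c) ^ (m / 2) := by
  rw [neg_one_pow_mul_neg_pow_half]
  obtain ⟨n, rfl | rfl⟩ := m.even_or_odd'
  · rw [prod_roots_eval_sum_range_two_mul (by omega), Nat.mul_div_cancel_left _ two_pos]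
  · rw [prod_roots_eval_sum_range_two_mul_add_one, show (2 * n + 1) / 2 = n by omega]

theorem resultant_chebS_combination_sum (m : ℕ) (hm : 1 ≤ m) (lam : ℂ) :
    res (chebS m - C lam * chebS ((m : ℤ) - 1)) (∑ k ∈ Finset.range m, chebS k) =
        (-1) ^ (m * (m - 1) / 2) * (-lam) ^ (m / 2) ∧
    ((chebS m - C lam * chebS ((m : ℤ) - 1)).roots.map fun mu =>
          ∑ k ∈ Finset.range m, (chebS k).eval mu).prod =
        (-1) ^ (m * (m - 1) / 2) * (-lam) ^ (m / 2) := by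
  refine ⟨?_, ?_⟩
  · rw [res_eq_prod_roots_eval (monic_chebS_sub m lam) (monic_sum_range_chebS hm)]
    exact prod_roots_eval_sum_range_chebS hm lam
  · simpa only [eval_finsetSum] using prod_roots_eval_sum_range_chebS hm lam
end

section
/- Let λ_1, …, λ_n be real numbers and m ≥ 1, and for each i let μ_i^{(1)}, …, μ_i^{(m)} be the roots (with multiplicity, over ℂ) of S_m(x) − λ_i·S_{m−1}(x). Then ∏_{i=1}^n ∏_{j=1}^m ∑_{k=0}^{m−1} S_k(μ_i^{(j)}) = (−1)^{m(m−1)n/2} · (∏_{i=1}^n (−λ_i))^⌊m/2⌋. In particular, if λ_1, …, λ_n are the eigenvalues of the adjacency matrix A of an n-vertex graph G, the right-hand side equals (−1)^{m(m−1)n/2}·a_0^⌊m/2⌋, where a_0 = (−1)^n det A is the constant term of the characteristic polynomial of G. -/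
open Polynomial

open Polynomial.Chebyshev (S S_add_two S_sq_add_S_sq)

theorem chebS_eq_S (k : ℤ) : chebS k = S ℂ k := by
  have : Invertible (2 : ℂ) := invertibleOfNonzero two_ne_zero
  rw [Polynomial.Chebyshev.S_eq_U_comp_half_mul_X, chebS, invOf_eq_inv]

theorem natDegree_S_natCast (n : ℕ) : (S ℂ n).natDegree = n := by
  rw [← chebS_eq_S, chebS, natDegree_comp, Polynomial.Chebyshev.natDegree_U_natCast,
    natDegree_C_mul_X _ (by simp), mul_one]

theorem monic_S_natCast (n : ℕ) : (S ℂ n).Monic := by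
  have h : (C (2⁻¹ : ℂ) * X).natDegree = 1 := natDegree_C_mul_X _ (by simp)
  rw [Monic, ← chebS_eq_S, chebS, leadingCoeff_comp (by simp [h]),
    Polynomial.Chebyshev.leadingCoeff_U_natCast, Polynomial.Chebyshev.natDegree_U_natCast,
    leadingCoeff_mul, leadingCoeff_C, leadingCoeff_X, mul_one, ← mul_pow]
  simp

theorem degree_S_natCast (n : ℕ) : (S ℂ n).degree = n := by
  rw [degree_eq_natDegree (monic_S_natCast n).ne_zero, natDegree_S_natCast]

theorem degree_S_sub_one_lt (n : ℕ) : (S ℂ ((n : ℤ) - 1)).degree < (S ℂ n).degree := by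
  rw [degree_S_natCast]
  cases n with
  | zero => simp
  | succ n =>
    rw [Nat.cast_succ, add_sub_cancel_right, degree_S_natCast]
    exact_mod_cast n.lt_succ_self

theorem degree_C_mul_S_sub_one_lt (c : ℂ) (n : ℕ) :
    (C c * S ℂ ((n : ℤ) - 1)).degree < (S ℂ n).degree := by
  refine lt_of_le_of_lt ?_ (degree_S_sub_one_lt n)
  rw [← smul_eq_C_mul]
  exact degree_smul_le c _

theorem monic_S_sub_C_mul_S (c : ℂ) (n : ℕ) : (S ℂ n - C c * S ℂ ((n : ℤ) - 1)).Monic :=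
  (monic_S_natCast n).sub_of_left (degree_C_mul_S_sub_one_lt c n)

theorem natDegree_S_sub_C_mul_S (c : ℂ) (n : ℕ) :
    (S ℂ n - C c * S ℂ ((n : ℤ) - 1)).natDegree = n := by
  rw [natDegree_eq_of_degree_eq (degree_sub_eq_left_of_degree_lt (degree_C_mul_S_sub_one_lt c n)),
    natDegree_S_natCast]

theorem monic_S_add_S (n : ℕ) : (S ℂ n + S ℂ ((n : ℤ) - 1)).Monic :=
  (monic_S_natCast n).add_of_left (degree_S_sub_one_lt n)

theorem natDegree_S_add_S (n : ℕ) : (S ℂ n + S ℂ ((n : ℤ) - 1)).natDegree = n := by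
  rw [natDegree_eq_of_degree_eq (degree_add_eq_left_of_degree_lt (degree_S_sub_one_lt n)),
    natDegree_S_natCast]

theorem S_two_mul_and_S_two_mul_add_one (j : ℕ) :
    S ℂ (2 * j) = S ℂ j ^ 2 - S ℂ (j - 1) ^ 2 ∧
      S ℂ (2 * j + 1) = S ℂ j * (S ℂ (j + 1) - S ℂ (j - 1)) := by
  induction j with
  | zero => simp
  | succ j ih =>
    obtain ⟨h₀, h₁⟩ := ih
    have r₁ := S_add_two ℂ ((j : ℤ) - 1)
    have r₂ := S_add_two ℂ (j : ℤ)
    have r₃ := S_add_two ℂ (2 * (j : ℤ))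
    have r₄ := S_add_two ℂ (2 * (j : ℤ) + 1)
    rw [show (j : ℤ) - 1 + 2 = j + 1 by ring, show (j : ℤ) - 1 + 1 = j by ring] at r₁
    rw [show 2 * (j : ℤ) + 1 + 2 = 2 * j + 3 by ring,
      show 2 * (j : ℤ) + 1 + 1 = 2 * j + 2 by ring] at r₄
    push_cast
    rw [show 2 * ((j : ℤ) + 1) = 2 * j + 2 by ring, show 2 * (j : ℤ) + 2 + 1 = 2 * j + 3 by ring,
      show (j : ℤ) + 1 - 1 = j by ring, show (j : ℤ) + 1 + 1 = j + 2 by ring,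
      r₄, r₃, r₂, h₀, h₁, r₁]
    constructor <;> ring

theorem S_two_mul (j : ℕ) : S ℂ (2 * j) = S ℂ j ^ 2 - S ℂ (j - 1) ^ 2 :=
  (S_two_mul_and_S_two_mul_add_one j).1

theorem S_two_mul_add_one (j : ℕ) :
    S ℂ (2 * j + 1) = S ℂ j * (S ℂ (j + 1) - S ℂ (j - 1)) :=
  (S_two_mul_and_S_two_mul_add_one j).2

theorem sum_S_range_two_mul_add_one (j : ℕ) :
    ∑ k ∈ Finset.range (2 * j + 1), S ℂ k = S ℂ j * (S ℂ j + S ℂ (j - 1)) := by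
  induction j with
  | zero => simp
  | succ j ih =>
    have h := S_two_mul (j + 1)
    push_cast at h
    rw [show 2 * (j + 1) + 1 = 2 * j + 1 + 1 + 1 by ring, Finset.sum_range_succ,
      Finset.sum_range_succ, ih]
    push_cast
    rw [S_two_mul_add_one, show 2 * (j : ℤ) + 2 = 2 * (j + 1) by ring, h,
      add_sub_cancel_right]
    ring

theorem sum_S_range_two_mul_add_two (j : ℕ) :
    ∑ k ∈ Finset.range (2 * j + 2), S ℂ k = S ℂ j * (S ℂ (j + 1) + S ℂ j) := by
  rw [Finset.sum_range_succ, sum_S_range_two_mul_add_one]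
  push_cast
  rw [S_two_mul_add_one]
  ring

theorem prod_roots_map_eval_of_dvd_sub_C {F G : ℂ[X]} (hF : F.Monic) (hG : G.Monic) {c : ℂ}
    (h : G ∣ F - C c) :
    (F.roots.map fun z => G.eval z).prod =
      (-1) ^ (F.natDegree * G.natDegree) * c ^ G.natDegree := by
  have hF' := resultant_eq_prod_eval F G G.natDegree le_rfl (IsAlgClosed.splits F)
  have hG' := resultant_eq_prod_eval G F F.natDegree le_rfl (IsAlgClosed.splits G)
  rw [hF.leadingCoeff, one_pow, one_mul] at hF'
  rw [hG.leadingCoeff, one_pow, one_mul] at hG'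
  have hc : G.roots.map F.eval = G.roots.map fun _ => c := by
    refine Multiset.map_congr rfl fun z hz => ?_
    obtain ⟨q, hq⟩ := h
    have := congrArg (eval z) hq
    rw [eval_mul, (isRoot_of_mem_roots hz).eq_zero, zero_mul, eval_sub, eval_C] at this
    exact sub_eq_zero.mp this
  rw [← hF', resultant_comm, hG', hc, Multiset.map_const', Multiset.prod_replicate,
    splits_iff_card_roots.mp (IsAlgClosed.splits G)]

theorem prod_sum_S_over_roots (c : ℂ) {m : ℕ} (hm : 1 ≤ m) :
    ((S ℂ m - C c * S ℂ ((m : ℤ) - 1)).roots.map fun z =>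
      (∑ k ∈ Finset.range m, S ℂ k).eval z).prod = c ^ (m / 2) := by
  obtain ⟨j, rfl | rfl⟩ : ∃ j, m = 2 * j + 1 ∨ m = 2 * j + 2 := ⟨(m - 1) / 2, by omega⟩
  · have hF := monic_S_sub_C_mul_S c (2 * j + 1)
    have dF := natDegree_S_sub_C_mul_S c (2 * j + 1)
    have hsq := S_sq_add_S_sq ℂ ((j : ℤ) - 1)
    have hrec := S_add_two ℂ ((j : ℤ) - 1)
    rw [show (j : ℤ) - 1 + 2 = j + 1 by ring, sub_add_cancel] at hrec
    rw [sub_add_cancel] at hsq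
    have hP : S ℂ ((2 * j + 1 : ℕ) : ℤ) - C c * S ℂ (((2 * j + 1 : ℕ) : ℤ) - 1) =
        S ℂ j * (S ℂ (j + 1) - S ℂ (j - 1)) - C c * (S ℂ j ^ 2 - S ℂ (j - 1) ^ 2) := by
      push_cast
      rw [add_sub_cancel_right, S_two_mul, S_two_mul_add_one]
    have hA := prod_roots_map_eval_of_dvd_sub_C (c := c) hF (monic_S_natCast j)
      ⟨S ℂ (j + 1) - S ℂ (j - 1) - 2 * C c * S ℂ j + C c * X * S ℂ (j - 1), by
        rw [hP]; linear_combination C c * hsq⟩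
    have hB := prod_roots_map_eval_of_dvd_sub_C (c := 1) hF (monic_S_add_S j)
      ⟨X * S ℂ j - (S ℂ j + S ℂ (j - 1)) - C c * (S ℂ j - S ℂ (j - 1)), by
        rw [hP, hrec, C_1]; linear_combination hsq⟩
    simp_rw [sum_S_range_two_mul_add_one, eval_mul]
    rw [Multiset.prod_map_mul, hA, hB, dF, natDegree_S_natCast, natDegree_S_add_S,
      show (2 * j + 1) / 2 = j by omega, one_pow, mul_one, mul_right_comm, ← pow_add,
      Even.neg_one_pow ⟨_, rfl⟩, one_mul]
  · have hF := monic_S_sub_C_mul_S c (2 * j + 2)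
    have dF := natDegree_S_sub_C_mul_S c (2 * j + 2)
    have hsq := S_sq_add_S_sq ℂ (j : ℤ)
    have hrec := Polynomial.Chebyshev.S_sub_one ℂ (j : ℤ)
    have hB' := monic_S_add_S (j + 1)
    have dB := natDegree_S_add_S (j + 1)
    have h₂ := S_two_mul (j + 1)
    push_cast at hB' dB h₂
    rw [add_sub_cancel_right] at hB' dB h₂
    have hP : S ℂ ((2 * j + 2 : ℕ) : ℤ) - C c * S ℂ (((2 * j + 2 : ℕ) : ℤ) - 1) =
        S ℂ (j + 1) ^ 2 - S ℂ j ^ 2 - C c * (S ℂ j * (S ℂ (j + 1) - S ℂ (j - 1))) := by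
      push_cast
      rw [show 2 * (j : ℤ) + 2 - 1 = 2 * j + 1 by ring,
        show 2 * (j : ℤ) + 2 = 2 * (j + 1) by ring, h₂, S_two_mul_add_one]
    have hA := prod_roots_map_eval_of_dvd_sub_C (c := 1) hF (monic_S_natCast j)
      ⟨X * S ℂ (j + 1) - 2 * S ℂ j - C c * (2 * S ℂ (j + 1) - X * S ℂ j), by
        rw [hP, hrec, C_1]; linear_combination hsq⟩
    have hB := prod_roots_map_eval_of_dvd_sub_C (c := c) hF hB'
      ⟨S ℂ (j + 1) - S ℂ j - C c * (S ℂ (j + 1) + S ℂ j) + C c * X * S ℂ j, by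
        rw [hP, hrec]; linear_combination C c * hsq⟩
    simp_rw [sum_S_range_two_mul_add_two, eval_mul]
    rw [Multiset.prod_map_mul, hA, hB, dF, natDegree_S_natCast, dB,
      show (2 * j + 2) / 2 = j + 1 by omega, one_pow, mul_one, ← mul_assoc, ← pow_add,
      Even.neg_one_pow ⟨(j + 1) * (2 * j + 1), by ring⟩, one_mul]

theorem neg_one_pow_mul_pred_mul_div_two (m n : ℕ) :
    (-1 : ℂ) ^ (m * (m - 1) * n / 2) = ((-1) ^ n) ^ (m / 2) := by
  rw [← pow_mul]
  obtain ⟨j, rfl | rfl⟩ := m.even_or_odd'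
  · cases j with
    | zero => simp
    | succ j =>
      rw [show 2 * (j + 1) * (2 * (j + 1) - 1) * n = 2 * ((j + 1) * (2 * j + 1) * n) by
          rw [show 2 * (j + 1) - 1 = 2 * j + 1 by omega]; ring,
        Nat.mul_div_cancel_left _ two_pos, Nat.mul_div_cancel_left _ two_pos,
        show (j + 1) * (2 * j + 1) * n = n * (j + 1) + 2 * (j * (j + 1) * n) by ring,
        pow_add, pow_mul (-1 : ℂ) 2]
      simp
  · rw [Nat.add_sub_cancel, show (2 * j + 1) * (2 * j) * n = 2 * (n * j + 2 * (j * j * n)) by ring,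
      Nat.mul_div_cancel_left _ two_pos, show (2 * j + 1) / 2 = j by omega, pow_add,
      pow_mul (-1 : ℂ) 2]
    simp

theorem prod_sum_chebS_over_roots {n : ℕ} (lam : Fin n → ℝ) (m : ℕ) (hm : 1 ≤ m) :
    ∏ i : Fin n,
        ((chebS m - C (lam i : ℂ) * chebS ((m : ℤ) - 1)).roots.map fun mu =>
          ∑ k ∈ Finset.range m, (chebS k).eval mu).prod =
      (-1) ^ (m * (m - 1) * n / 2) * (∏ i : Fin n, -(lam i : ℂ)) ^ (m / 2) := by
  simp_rw [chebS_eq_S, ← eval_finsetSum, prod_sum_S_over_roots _ hm]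
  rw [neg_one_pow_mul_pred_mul_div_two, Finset.prod_pow, ← mul_pow, Finset.prod_neg,
    Finset.card_univ, Fintype.card_fin, ← mul_assoc, ← mul_pow]
  simp
end
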